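/- arXiv:1211.4007 — 2 statements merged into one kernel-verified Lean document; each statement's English description precedes it below -/
import Mathlib

section
/- Let F be an integrable function on (0,∞) such that for some ε>0 and a>−1: F(x)=x^a·∑_{n=0}^∞ aₙxⁿ for all x∈(0,ε), with the power series convergent on (−ε,ε). Then for every d≥1 and all t₁,…,t_d>0 there exists δ>0 such that for all x∈(0,δ): (F_{t₁}*⋯*F_{t_d})(x) = x^{d·a}/(t₁⋯t_d)^{1+a} · ∑_{n=0}^∞ ( ∑_{k₁+⋯+k_d=n} ∏_{i=1}^d (a_{k_i}·Γ(k_i+1+a)/t_i^{k_i}) · 1/Γ(n+d+d·a) )·x^{n+d−1}. -/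
open MeasureTheory Set

/-- Convolution of two real functions. -/
noncomputable def conv (F G : ℝ → ℝ) : ℝ → ℝ := fun x => ∫ y, F y * G (x - y)

/-- Iterated convolution of a list of functions. -/
noncomputable def multiConv : List (ℝ → ℝ) → (ℝ → ℝ)
  | [] => fun _ => 0
  | [f] => f
  | f :: g :: fs => conv f (multiConv (g :: fs))

/-- The rescaling `F_t(x) = (1/|t|)·F(x/t)`. -/
noncomputable def rescale (t : ℝ) (F : ℝ → ℝ) : ℝ → ℝ := fun x => (1 / |t|) * F (x / t)

/-- The function `G` vanishes on `(-∞, 0]` and, near `0⁺`, it is the sum of the series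
`∑ cₙ / Γ(n + b) · x^(n + b - 1)`. -/
def HasGammaExpansion (G : ℝ → ℝ) (b : ℝ) (c : ℕ → ℝ) : Prop :=
  (∀ x ≤ (0 : ℝ), G x = 0) ∧ ∃ δ > (0 : ℝ), ∀ x ∈ Ioo (0 : ℝ) δ,
    HasSum (fun n : ℕ => c n / Real.Gamma (n + b) * x ^ ((n : ℝ) + b - 1)) (G x)

/-- The Beta integral over `(0, x)`. -/
theorem setIntegral_rpow_mul_sub_rpow {s t x : ℝ} (hs : 0 < s) (ht : 0 < t) (hx : 0 < x) :
    ∫ y in Ioo 0 x, y ^ (s - 1) * (x - y) ^ (t - 1) =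
      Real.Gamma s * Real.Gamma t / Real.Gamma (s + t) * x ^ (s + t - 1) := by
  have h := Complex.betaIntegral_scaled s t hx
  rw [Complex.betaIntegral_eq_Gamma_mul_div _ _ (by simpa) (by simpa),
    intervalIntegral.integral_of_le hx.le, integral_Ioc_eq_integral_Ioo] at h
  apply Complex.ofReal_injective
  rw [← integral_complex_ofReal]
  calc _ = ∫ y in Ioo 0 x, (y : ℂ) ^ ((s : ℂ) - 1) * ((x : ℂ) - y) ^ ((t : ℂ) - 1) := by
        refine setIntegral_congr_fun measurableSet_Ioo fun y hy => ?_
        simp only [Complex.ofReal_mul]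
        rw [Complex.ofReal_cpow hy.1.le, Complex.ofReal_cpow (sub_nonneg.2 hy.2.le)]
        push_cast
        rfl
    _ = _ := by
        rw [h]
        push_cast
        rw [Complex.ofReal_cpow hx.le]
        simp only [← Complex.Gamma_ofReal]
        push_cast
        ring

theorem integrableOn_rpow_mul_sub_rpow {s t x : ℝ} (hs : 0 < s) (ht : 0 < t) (hx : 0 < x) :
    IntegrableOn (fun y : ℝ => y ^ (s - 1) * (x - y) ^ (t - 1)) (Ioo 0 x) := by
  refine Integrable.of_integral_ne_zero ?_
  rw [setIntegral_rpow_mul_sub_rpow hs ht hx]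
  have := Real.Gamma_pos_of_pos hs
  have := Real.Gamma_pos_of_pos ht
  have := Real.Gamma_pos_of_pos (add_pos hs ht)
  positivity

/-- Raising the exponents by natural numbers costs at most the corresponding power of `x`. -/
theorem setIntegral_rpow_mul_sub_rpow_le {s t x : ℝ} (hs : 0 < s) (ht : 0 < t) (hx : 0 < x)
    (n m : ℕ) :
    ∫ y in Ioo 0 x, y ^ ((n : ℝ) + s - 1) * (x - y) ^ ((m : ℝ) + t - 1) ≤
      x ^ n * x ^ m * ∫ y in Ioo 0 x, y ^ (s - 1) * (x - y) ^ (t - 1) := by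
  rw [← integral_const_mul]
  refine setIntegral_mono_on (integrableOn_rpow_mul_sub_rpow (by positivity) (by positivity) hx)
    ((integrableOn_rpow_mul_sub_rpow hs ht hx).const_mul _) measurableSet_Ioo fun y hy => ?_
  have hy' : 0 < x - y := sub_pos.2 hy.2
  rw [add_sub_assoc, Real.rpow_add hy.1, add_sub_assoc, Real.rpow_add hy', Real.rpow_natCast,
    Real.rpow_natCast, mul_mul_mul_comm]
  have h1 := Real.rpow_pos_of_pos hy.1 (s - 1)
  have h2 := Real.rpow_pos_of_pos hy' (t - 1)
  have h3 : y ^ n ≤ x ^ n := pow_le_pow_left₀ hy.1.le hy.2.le n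
  have h4 : (x - y) ^ m ≤ x ^ m := pow_le_pow_left₀ hy'.le (by linarith [hy.1]) m
  gcongr

/-- Convolution of functions vanishing on `(-∞, 0]` is an integral over `(0, x)`. -/
theorem conv_eq_setIntegral {G H : ℝ → ℝ} (hG : ∀ x ≤ (0 : ℝ), G x = 0)
    (hH : ∀ x ≤ (0 : ℝ), H x = 0) (x : ℝ) :
    conv G H x = ∫ y in Ioo 0 x, G y * H (x - y) := by
  refine (setIntegral_eq_integral_of_forall_compl_eq_zero fun y hy => ?_).symm
  by_cases h : 0 < y
  · rw [hH _ (by by_contra! h'; exact hy ⟨h, by linarith⟩), mul_zero]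
  · rw [hG _ (not_lt.1 h), zero_mul]

/-- Under convolution the exponents add and the coefficients undergo the Cauchy product. -/
theorem HasGammaExpansion.conv {G H : ℝ → ℝ} {b b' : ℝ} {c c' : ℕ → ℝ} (hb : 0 < b) (hb' : 0 < b')
    (hG : HasGammaExpansion G b c) (hH : HasGammaExpansion H b' c') :
    HasGammaExpansion (conv G H) (b + b')
      (fun N => ∑ p ∈ Finset.HasAntidiagonal.antidiagonal N, c p.1 * c' p.2) := by
  obtain ⟨hG0, δ, hδ, hG⟩ := hG
  obtain ⟨hH0, δ', hδ', hH⟩ := hH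
  refine ⟨fun x hx => ?_, min δ δ', lt_min hδ hδ', fun x ⟨hx, hxδ⟩ => ?_⟩
  · rw [conv_eq_setIntegral hG0 hH0, Ioo_eq_empty (by simpa using hx)]
    simp
  have hxδ1 : x < δ := hxδ.trans_le (min_le_left _ _)
  have hxδ2 : x < δ' := hxδ.trans_le (min_le_right _ _)
  set e : ℕ → ℝ := fun n => c n / Real.Gamma (n + b) with he
  set e' : ℕ → ℝ := fun n => c' n / Real.Gamma (n + b') with he'
  set K : ℕ × ℕ → ℝ → ℝ := fun p y =>
    (e p.1 * e' p.2) * (y ^ ((p.1 : ℝ) + b - 1) * (x - y) ^ ((p.2 : ℝ) + b' - 1)) with hK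
  have hKint : ∀ p, Integrable (K p) (volume.restrict (Ioo 0 x)) := fun p =>
    (integrableOn_rpow_mul_sub_rpow (by positivity) (by positivity) hx).const_mul _
  have hsum_prod : Summable fun p : ℕ × ℕ => |e p.1 * x ^ ((p.1 : ℝ) + b - 1)| *
      |e' p.2 * x ^ ((p.2 : ℝ) + b' - 1)| :=
    Summable.mul_of_nonneg (hG x ⟨hx, hxδ1⟩).summable.abs (hH x ⟨hx, hxδ2⟩).summable.abs
      (fun _ => abs_nonneg _) (fun _ => abs_nonneg _)
  have hKsum : Summable fun p => ∫ y in Ioo 0 x, ‖K p y‖ := by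
    set I := ∫ y in Ioo 0 x, y ^ (b - 1) * (x - y) ^ (b' - 1)
    refine Summable.of_nonneg_of_le (fun p => by positivity) (fun p => ?_)
      (hsum_prod.mul_left (I * (x ^ (b - 1) * x ^ (b' - 1))⁻¹))
    calc ∫ y in Ioo 0 x, ‖K p y‖
        = |e p.1 * e' p.2| *
            ∫ y in Ioo 0 x, y ^ ((p.1 : ℝ) + b - 1) * (x - y) ^ ((p.2 : ℝ) + b' - 1) := by
          rw [← integral_const_mul]
          refine setIntegral_congr_fun measurableSet_Ioo fun y hy => ?_
          have h1 := Real.rpow_pos_of_pos hy.1 ((p.1 : ℝ) + b - 1)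
          have h2 := Real.rpow_pos_of_pos (sub_pos.2 hy.2) ((p.2 : ℝ) + b' - 1)
          simp only [hK, Real.norm_eq_abs]
          rw [abs_mul, abs_of_pos (mul_pos h1 h2)]
      _ ≤ |e p.1 * e' p.2| * (x ^ p.1 * x ^ p.2 * I) := by
          gcongr
          exact setIntegral_rpow_mul_sub_rpow_le hb hb' hx _ _
      _ = _ := by
          have h1 := Real.rpow_pos_of_pos hx (b - 1)
          have h2 := Real.rpow_pos_of_pos hx (b' - 1)
          rw [add_sub_assoc, Real.rpow_add hx, add_sub_assoc, Real.rpow_add hx,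
            Real.rpow_natCast, Real.rpow_natCast, abs_mul, abs_mul (e p.1), abs_mul (e' p.2),
            abs_of_pos (mul_pos (pow_pos hx p.1) h1), abs_of_pos (mul_pos (pow_pos hx p.2) h2)]
          field_simp
  have hpt : ∀ y ∈ Ioo 0 x, ∑' p, K p y = G y * H (x - y) := by
    intro y hy
    have h1 := hG y ⟨hy.1, hy.2.trans hxδ1⟩
    have h2 := hH (x - y) ⟨sub_pos.2 hy.2, by linarith [hy.1]⟩
    rw [← h1.tsum_eq, ← h2.tsum_eq,
      tsum_mul_tsum_of_summable_norm h1.summable.norm h2.summable.norm]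
    refine tsum_congr fun p => ?_
    simp only [hK, he, he']
    ring
  have hmain := hasSum_integral_of_summable_integral_norm hKint hKsum
  rw [setIntegral_congr_fun measurableSet_Ioo hpt, ← conv_eq_setIntegral hG0 hH0] at hmain
  have hsig := (Finset.HasAntidiagonal.sigmaAntidiagonalEquivProd (A := ℕ)).hasSum_iff.mpr hmain
  refine (hsig.sigma fun N => hasSum_fintype _).congr_fun ?_
  intro N
  rw [Finset.sum_div, Finset.sum_mul, ← Finset.sum_coe_sort]
  refine Finset.sum_congr rfl fun p _ => ?_
  obtain ⟨⟨n, m⟩, hp⟩ := p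
  have hN : n + m = N := by simpa using hp
  subst hN
  simp only [Function.comp_apply, Finset.HasAntidiagonal.sigmaAntidiagonalEquivProd_apply, hK]
  rw [integral_const_mul, setIntegral_rpow_mul_sub_rpow (by positivity) (by positivity) hx]
  have g1 := (Real.Gamma_pos_of_pos (by positivity : 0 < (n : ℝ) + b)).ne'
  have g2 := (Real.Gamma_pos_of_pos (by positivity : 0 < (m : ℝ) + b')).ne'
  simp only [he, he']
  rw [show (n : ℝ) + b + (m + b') = ((n + m : ℕ) : ℝ) + (b + b') by push_cast; ring]
  field_simp

/-- A sum over tuples of length `d + 1` splits off the first entry. -/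
theorem sum_antidiagonalTuple_succ {M : Type*} [AddCommMonoid M] (d N : ℕ)
    (f : (Fin (d + 1) → ℕ) → M) :
    ∑ k ∈ Finset.Nat.antidiagonalTuple (d + 1) N, f k =
      ∑ p ∈ Finset.HasAntidiagonal.antidiagonal N, ∑ k ∈ Finset.Nat.antidiagonalTuple d p.2,
        f (Fin.cons p.1 k) := by
  rw [Finset.sum_sigma']
  refine Finset.sum_bij' (fun k _ => ⟨(k 0, ∑ i, Fin.tail k i), Fin.tail k⟩)
    (fun q _ => Fin.cons q.1.1 q.2) ?_ ?_ ?_ ?_ ?_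
  · intro k hk
    rw [Finset.Nat.mem_antidiagonalTuple, Fin.sum_univ_succ] at hk
    simp [Finset.Nat.mem_antidiagonalTuple, Fin.tail, hk]
  · rintro ⟨⟨n, m⟩, k⟩ hq
    simp only [Finset.mem_sigma, Finset.HasAntidiagonal.mem_antidiagonal, Finset.Nat.mem_antidiagonalTuple] at hq
    simp [Finset.Nat.mem_antidiagonalTuple, Fin.sum_univ_succ, hq]
  · intro k _
    simp
  · rintro ⟨⟨n, m⟩, k⟩ hq
    simp only [Finset.mem_sigma, Finset.HasAntidiagonal.mem_antidiagonal, Finset.Nat.mem_antidiagonalTuple] at hq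
    simp [hq]
  · intro k _
    simp

theorem HasGammaExpansion.multiConv {b : ℝ} (hb : 0 < b) (d : ℕ) (G : Fin (d + 1) → ℝ → ℝ)
    (c : Fin (d + 1) → ℕ → ℝ) (h : ∀ i, HasGammaExpansion (G i) b (c i)) :
    HasGammaExpansion (multiConv (List.ofFn G)) ((d + 1 : ℕ) * b)
      (fun n => ∑ k ∈ Finset.Nat.antidiagonalTuple (d + 1) n, ∏ i, c i (k i)) := by
  induction d with
  | zero => simpa [_root_.multiConv, Finset.Nat.antidiagonalTuple_one] using h 0
  | succ d ih =>
    have key := HasGammaExpansion.conv hb (by positivity) (h 0)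
      (ih (fun i => G i.succ) (fun i => c i.succ) fun i => h i.succ)
    convert key using 1
    · simp [List.ofFn_succ, _root_.multiConv]
    · push_cast
      ring
    · funext n
      rw [sum_antidiagonalTuple_succ]
      refine Finset.sum_congr rfl fun p _ => ?_
      rw [Finset.mul_sum]
      refine Finset.sum_congr rfl fun k _ => ?_
      rw [Fin.prod_univ_succ]
      simp

theorem HasGammaExpansion.rescale {F : ℝ → ℝ} {a : ℝ} (ha : -1 < a) {A : ℕ → ℝ} {ε : ℝ}
    (hε : 0 < ε) (hsupp : ∀ x ≤ (0 : ℝ), F x = 0)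
    (hsum : ∀ x ∈ Ioo (-ε) ε, Summable fun n => A n * x ^ n)
    (hF : ∀ x ∈ Ioo (0 : ℝ) ε, F x = x ^ a * ∑' n, A n * x ^ n) {t : ℝ} (ht : 0 < t) :
    HasGammaExpansion (rescale t F) (1 + a)
      (fun k => A k * Real.Gamma ((k : ℝ) + 1 + a) / t ^ k * (t ^ (1 + a))⁻¹) := by
  refine ⟨fun x hx => ?_, t * ε, mul_pos ht hε, fun x ⟨hx, hxε⟩ => ?_⟩
  · rw [_root_.rescale, hsupp _ (div_nonpos_of_nonpos_of_nonneg hx ht.le), mul_zero]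
  · have hxt : 0 < x / t := div_pos hx ht
    have hxt' : x / t < ε := by rwa [div_lt_iff₀' ht]
    have h := (hsum (x / t) ⟨by linarith, hxt'⟩).hasSum.mul_left (1 / |t| * (x / t) ^ a)
    rw [mul_assoc, ← hF _ ⟨hxt, hxt'⟩] at h
    refine h.congr_fun fun n => ?_
    have g := (Real.Gamma_pos_of_pos (by linarith [n.cast_nonneg (α := ℝ)] :
      0 < (n : ℝ) + 1 + a)).ne'
    rw [show (n : ℝ) + (1 + a) - 1 = n + a by ring, ← add_assoc, Real.rpow_add hx,
      Real.rpow_natCast, Real.rpow_add ht, Real.rpow_one, Real.div_rpow hx.le ht.le, div_pow,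
      abs_of_pos ht]
    have := Real.rpow_pos_of_pos ht a
    field_simp

/-- series expansion near `0⁺` of `F_{t₁} * ⋯ * F_{t_d}` for
`t₁,…,t_d > 0`, where `F(x) = x^a·∑ aₙxⁿ` near `0⁺`. -/
theorem stmt4 (F : ℝ → ℝ) (a : ℝ) (ha : -1 < a) (A : ℕ → ℝ) (ε : ℝ) (hε : 0 < ε)
    (hsupp : ∀ x ≤ (0:ℝ), F x = 0)
    (hint : IntegrableOn F (Ioi 0))
    (hsum : ∀ x ∈ Ioo (-ε) ε, Summable fun n => A n * x ^ n)
    (hF : ∀ x ∈ Ioo (0:ℝ) ε, F x = x ^ a * ∑' n, A n * x ^ n)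
    (d : ℕ) (hd : 1 ≤ d) (t : Fin d → ℝ) (ht : ∀ i, 0 < t i) :
    ∃ δ > (0:ℝ), ∀ x ∈ Ioo (0:ℝ) δ,
      multiConv (List.ofFn fun i => rescale (t i) F) x =
        x ^ ((d : ℝ) * a) / (∏ i, t i) ^ (1 + a) *
          ∑' n : ℕ, (∑ k ∈ Finset.Nat.antidiagonalTuple d n,
              (∏ i, A (k i) * Real.Gamma ((k i : ℝ) + 1 + a) / t i ^ (k i)) *
                (1 / Real.Gamma ((n : ℝ) + d + d * a))) * x ^ (n + d - 1) := by
  obtain ⟨d, rfl⟩ : ∃ e, d = e + 1 := ⟨d - 1, by omega⟩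
  obtain ⟨-, δ, hδ, h⟩ := HasGammaExpansion.multiConv (by linarith : 0 < 1 + a) d _ _
    fun i => HasGammaExpansion.rescale ha hε hsupp hsum hF (ht i)
  refine ⟨δ, hδ, fun x hx => ?_⟩
  rw [← (h x hx).tsum_eq, ← tsum_mul_left]
  refine tsum_congr fun n => ?_
  have hP : (∏ i, t i) ^ (1 + a) = ∏ i, t i ^ (1 + a) :=
    (Real.finsetProd_rpow _ _ (fun i _ => (ht i).le) _).symm
  simp only [Finset.prod_mul_distrib, Finset.prod_inv_distrib, ← hP, ← Finset.sum_mul]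
  have hx' : x ^ ((n : ℝ) + ((d + 1 : ℕ) : ℝ) * (1 + a) - 1) =
      x ^ (((d + 1 : ℕ) : ℝ) * a) * x ^ (n + (d + 1) - 1) := by
    rw [← Real.rpow_natCast, ← Real.rpow_add hx.1]
    congr 1
    rw [show n + (d + 1) - 1 = n + d by omega]
    push_cast
    ring
  rw [hx', show (n : ℝ) + ((d + 1 : ℕ) : ℝ) + ((d + 1 : ℕ) : ℝ) * a =
    n + ((d + 1 : ℕ) : ℝ) * (1 + a) by ring]
  ring
end

section
/- Let a∈(−1,0). Suppose (F₁,F₂) and (G₁,G₂) are two pairs of functions satisfying: F₁,G₁ are integrable on (0,∞) and F₂,G₂ are integrable on (−∞,0); for some ε>0, F₁(x)=x^a·∑_{n=0}^∞ Bₙxⁿ and G₁(x)=x^a·∑_{n=0}^∞ B′ₙxⁿ for x∈(0,ε), with the power series convergent on (−ε,ε); F₂ and G₂ are analytic at zero with F₂(x)=∑_{n=0}^∞ Cₙxⁿ and G₂(x)=∑_{n=0}^∞ C′ₙxⁿ for x∈(−ε,0); all four functions are smooth on their domains with all derivatives decaying sufficiently fast; and all derivatives of F₁*F₂ and of G₁*G₂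 decay sufficiently fast. If ∑_{k∈ℤ}(F₁*F₂)(x+k) = ∑_{k∈ℤ}(G₁*G₂)(x+k) for all x∈(−1/2,1/2)∖{0}, then for every n≥1: ∑_{k=0}^{n} B_{n−k}·C_k·Γ(k+1)·Γ(a+n−k+1)/Γ(n+a+2) = ∑_{k=0}^{n} B′_{n−k}·C′_k·Γ(k+1)·Γ(a+n−k+1)/Γ(n+a+2). -/
open MeasureTheory Set

/-- All the derivatives of `F` decay "sufficiently fast". -/
def DecaysFast (F : ℝ → ℝ) : Prop :=
  ∀ n : ℕ, ∃ x₀ > (0:ℝ), ∃ H : ℝ → ℝ,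
    AntitoneOn H (Set.Ioi x₀) ∧ MeasureTheory.IntegrableOn H (Set.Ioi x₀) ∧
    ∀ x : ℝ, x₀ < |x| → |iteratedDeriv n F x| ≤ H |x|

open scoped ContDiff Topology
open Filter

theorem iteratedDeriv_eqOn_of_hasDerivAt_succ {U : Set ℝ} (hU : IsOpen U) {φ : ℕ → ℝ → ℝ}
    (h : ∀ n, ∀ x ∈ U, HasDerivAt (φ n) (φ (n + 1) x) x) (n : ℕ) :
    EqOn (iteratedDeriv n (φ 0)) (φ n) U := by
  induction n with
  | zero => intro x _; simp
  | succ n ih =>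
    intro x hx
    rw [iteratedDeriv_succ, (ih.eventuallyEq_of_mem (hU.mem_nhds hx)).deriv_eq]
    exact (h n x hx).deriv

theorem contDiffOn_infty_of_hasDerivAt_succ {U : Set ℝ} (hU : IsOpen U) {φ : ℕ → ℝ → ℝ}
    (h : ∀ n, ∀ x ∈ U, HasDerivAt (φ n) (φ (n + 1) x) x) : ContDiffOn ℝ ∞ (φ 0) U := by
  refine contDiffOn_infty.2 fun n => ?_
  have key : ∀ n m : ℕ, ContDiffOn ℝ n (φ m) U := by
    intro n
    induction n with
    | zero =>
      intro m
      exact contDiffOn_zero.2 fun x hx => (h m x hx).continuousAt.continuousWithinAt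
    | succ n ih =>
      intro m
      push_cast
      refine (contDiffOn_succ_iff_deriv_of_isOpen hU).2
        ⟨fun x hx => (h m x hx).differentiableAt.differentiableWithinAt, by simp, ?_⟩
      exact (ih (m + 1)).congr fun x hx => (h m x hx).deriv
  exact key n 0

theorem hasDerivAt_iteratedDeriv {f : ℝ → ℝ} {x : ℝ} (hf : ContDiffAt ℝ ∞ f x) (n : ℕ) :
    HasDerivAt (iteratedDeriv n f) (iteratedDeriv (n + 1) f x) x := by
  rw [iteratedDeriv_succ]
  have h := ContDiffWithinAt.differentiableWithinAt_iteratedDerivWithin (m := n)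
    (contDiffWithinAt_univ.2 hf) (by exact_mod_cast WithTop.coe_lt_top n)
    (by simp)
  rw [iteratedDerivWithin_univ, differentiableWithinAt_univ] at h
  exact h.hasDerivAt

theorem iteratedDeriv_integral_of_bounded {α : Type*} [MeasurableSpace α] {μ : Measure α}
    {w : α → ℝ} (hw : Integrable w μ) {K : α → ℝ → ℝ} (hK : ∀ s, ContDiff ℝ ∞ (K s))
    (hmeas : ∀ n x, AEStronglyMeasurable (fun s => iteratedDeriv n (K s) x) μ)
    (hbdd : ∀ n, ∃ M, ∀ᵐ s ∂μ, ∀ x, |iteratedDeriv n (K s) x| ≤ M) :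
    ContDiff ℝ ∞ (fun x => ∫ s, w s * K s x ∂μ) ∧
      ∀ n x, iteratedDeriv n (fun x => ∫ s, w s * K s x ∂μ) x =
        ∫ s, w s * iteratedDeriv n (K s) x ∂μ := by
  have h : ∀ n, ∀ x ∈ (univ : Set ℝ), HasDerivAt (fun x => ∫ s, w s * iteratedDeriv n (K s) x ∂μ)
      (∫ s, w s * iteratedDeriv (n + 1) (K s) x ∂μ) x := by
    intro n x _
    obtain ⟨M, hM⟩ := hbdd n
    obtain ⟨M', hM'⟩ := hbdd (n + 1)
    refine (hasDerivAt_integral_of_dominated_loc_of_deriv_le (𝕜 := ℝ) (s := univ)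
      (F := fun x s => w s * iteratedDeriv n (K s) x)
      (F' := fun x s => w s * iteratedDeriv (n + 1) (K s) x)
      (bound := fun s => |w s| * M') univ_mem ?_ ?_ ?_ ?_ ?_ ?_).2
    · exact Eventually.of_forall fun y => hw.aestronglyMeasurable.mul (hmeas n y)
    · exact hw.mul_bdd (hmeas n x) (hM.mono fun s hs => hs x)
    · exact hw.aestronglyMeasurable.mul (hmeas (n + 1) x)
    · filter_upwards [hM'] with s hs y _
      rw [norm_mul]
      exact mul_le_mul_of_nonneg_left (hs y) (abs_nonneg _)
    · exact hw.abs.mul_const M'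
    · exact Eventually.of_forall fun s y _ =>
        (hasDerivAt_iteratedDeriv (hK s).contDiffAt n).const_mul (w s)
  have h0 : (fun x => ∫ s, w s * K s x ∂μ) = fun x => ∫ s, w s * iteratedDeriv 0 (K s) x ∂μ := by
    simp
  rw [h0]
  exact ⟨contDiffOn_univ.1 (contDiffOn_infty_of_hasDerivAt_succ
      (φ := fun n x => ∫ s, w s * iteratedDeriv n (K s) x ∂μ) isOpen_univ h),
    fun n x => iteratedDeriv_eqOn_of_hasDerivAt_succ
      (φ := fun n x => ∫ s, w s * iteratedDeriv n (K s) x ∂μ) isOpen_univ h n (mem_univ x)⟩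

/-- Smooth functions all of whose derivatives are bounded. -/
structure BddSmooth (f : ℝ → ℝ) : Prop where
  contDiff : ContDiff ℝ ∞ f
  bounded : ∀ n, ∃ M, ∀ x, |iteratedDeriv n f x| ≤ M

theorem BddSmooth.continuous_iteratedDeriv {f : ℝ → ℝ} (hf : BddSmooth f) (n : ℕ) :
    Continuous (iteratedDeriv n f) :=
  hf.contDiff.continuous_iteratedDeriv n (by exact_mod_cast le_top)

theorem BddSmooth.contDiff_convolution {f : ℝ → ℝ} (hf : BddSmooth f) {w : ℝ → ℝ}
    (hw : Integrable w) : ContDiff ℝ ∞ (fun x => ∫ y, w y * f (x - y)) := by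
  refine (iteratedDeriv_integral_of_bounded hw (K := fun s x => f (x - s)) ?_ ?_ ?_).1
  · exact fun s => hf.contDiff.comp (contDiff_id.sub contDiff_const)
  · intro n x
    simp only [iteratedDeriv_comp_sub_const]
    exact ((hf.continuous_iteratedDeriv n).comp
      (continuous_const.sub continuous_id)).aestronglyMeasurable
  · intro n
    obtain ⟨M, hM⟩ := hf.bounded n
    refine ⟨M, Eventually.of_forall fun s x => ?_⟩
    simp only [iteratedDeriv_comp_sub_const]
    exact hM _

theorem BddSmooth.of_hasCompactSupport {f : ℝ → ℝ} (hf : ContDiff ℝ ∞ f)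
    (hc : HasCompactSupport f) : BddSmooth f := by
  refine ⟨hf, fun n => ?_⟩
  have hcont : Continuous (iteratedDeriv n f) :=
    hf.continuous_iteratedDeriv n (by exact_mod_cast le_top)
  have hcs : HasCompactSupport (iteratedDeriv n f) := by
    rw [iteratedDeriv_eq_iterate]
    induction n with
    | zero => simpa
    | succ n ih =>
      rw [Function.iterate_succ_apply']
      exact (ih (hf.continuous_iteratedDeriv n (by exact_mod_cast le_top))).deriv
  exact hcs.exists_bound_of_continuous hcont

/-- The weighted integral `∫₀¹ s^a b(sx) c((1-s)x) ds` arising from the convolution of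
`y^a b(y)` with `c` by rescaling. -/
noncomputable def scaledBeta (a : ℝ) (b c : ℝ → ℝ) (x : ℝ) : ℝ :=
  ∫ s in Ioc (0 : ℝ) 1, s ^ a * (b (s * x) * c ((1 - s) * x))

theorem iteratedDeriv_mul_scaled {b c : ℝ → ℝ} (hb : ContDiff ℝ ∞ b) (hc : ContDiff ℝ ∞ c)
    (n : ℕ) (s x : ℝ) :
    iteratedDeriv n (fun x => b (s * x) * c ((1 - s) * x)) x =
      ∑ i ∈ Finset.range (n + 1), (n.choose i : ℝ) * (s ^ i * iteratedDeriv i b (s * x)) *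
        ((1 - s) ^ (n - i) * iteratedDeriv (n - i) c ((1 - s) * x)) := by
  have hb' : ∀ n : ℕ, ContDiff ℝ n b := contDiff_infty.1 hb
  have hc' : ∀ n : ℕ, ContDiff ℝ n c := contDiff_infty.1 hc
  rw [iteratedDeriv_fun_mul (f := fun x => b (s * x)) (g := fun x => c ((1 - s) * x))
    ((hb' n).comp (contDiff_const.mul contDiff_id)).contDiffAt
    ((hc' n).comp (contDiff_const.mul contDiff_id)).contDiffAt]
  refine Finset.sum_congr rfl fun i _ => ?_
  rw [iteratedDeriv_comp_const_mul (hb' i), iteratedDeriv_comp_const_mul (hc' (n - i))]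

theorem integrableOn_rpow_Ioc {a : ℝ} (ha : -1 < a) :
    IntegrableOn (fun s : ℝ => s ^ a) (Ioc 0 1) :=
  (intervalIntegrable_iff_integrableOn_Ioc_of_le zero_le_one).1
    (intervalIntegral.intervalIntegrable_rpow' ha)

theorem contDiff_scaledBeta {a : ℝ} (ha : -1 < a) {b c : ℝ → ℝ} (hb : BddSmooth b)
    (hc : BddSmooth c) : ContDiff ℝ ∞ (scaledBeta a b c) ∧
      ∀ n x, iteratedDeriv n (scaledBeta a b c) x =
        ∫ s in Ioc (0 : ℝ) 1, s ^ a * iteratedDeriv n (fun x => b (s * x) * c ((1 - s) * x)) x := by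
  have hbc := hb.continuous_iteratedDeriv
  have hcc := hc.continuous_iteratedDeriv
  refine iteratedDeriv_integral_of_bounded (integrableOn_rpow_Ioc ha)
    (K := fun s x => b (s * x) * c ((1 - s) * x)) ?_ ?_ ?_
  · exact fun s => (hb.contDiff.comp (contDiff_const.mul contDiff_id)).mul
      (hc.contDiff.comp (contDiff_const.mul contDiff_id))
  · intro n x
    simp only [iteratedDeriv_mul_scaled hb.contDiff hc.contDiff]
    exact Continuous.aestronglyMeasurable (by fun_prop)
  · intro n
    choose Mb hMb using hb.bounded
    choose Mc hMc using hc.bounded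
    refine ⟨∑ i ∈ Finset.range (n + 1), (n.choose i : ℝ) * (1 * Mb i) * (1 * Mc (n - i)), ?_⟩
    filter_upwards [ae_restrict_mem measurableSet_Ioc] with s hs x
    rw [iteratedDeriv_mul_scaled hb.contDiff hc.contDiff]
    refine (Finset.abs_sum_le_sum_abs _ _).trans (Finset.sum_le_sum fun i _ => ?_)
    have hMb0 : 0 ≤ Mb i := (abs_nonneg _).trans (hMb i 0)
    have h1 : |s ^ i| ≤ 1 := by
      rw [abs_pow, abs_of_pos hs.1]; exact pow_le_one₀ hs.1.le hs.2
    have h2 : |(1 - s) ^ (n - i)| ≤ 1 := by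
      rw [abs_pow, abs_of_nonneg (by linarith [hs.2])]
      exact pow_le_one₀ (by linarith [hs.2]) (by linarith [hs.1])
    simp only [abs_mul, Nat.abs_cast]
    gcongr
    · exact hMb i _
    · exact hMc _ _

theorem integral_rpow_mul_pow_mul_one_sub_pow {a : ℝ} (ha : -1 < a) (i j : ℕ) :
    ∫ s in Ioc (0 : ℝ) 1, s ^ a * (s ^ i * (1 - s) ^ j) =
      Real.Gamma (a + i + 1) * Real.Gamma (j + 1) / Real.Gamma (a + i + j + 2) := by
  have h := Complex.betaIntegral_eq_Gamma_mul_div ((a + i + 1 : ℝ) : ℂ) ((j + 1 : ℝ) : ℂ)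
    (by rw [Complex.ofReal_re]; have := Nat.cast_nonneg (α := ℝ) i; linarith)
    (by rw [Complex.ofReal_re]; positivity)
  rw [← Complex.ofReal_add, Complex.Gamma_ofReal, Complex.Gamma_ofReal, Complex.Gamma_ofReal,
    Complex.betaIntegral, intervalIntegral.integral_of_le zero_le_one] at h
  rw [← Complex.ofReal_inj, ← integral_complex_ofReal]
  push_cast
  rw [show a + i + j + 2 = a + i + 1 + (j + 1) by ring, ← h]
  refine setIntegral_congr_fun measurableSet_Ioc fun s hs => ?_
  have h1 : ((s : ℂ)) ^ (((a + i + 1 : ℝ) : ℂ) - 1) = ((s ^ a : ℝ) : ℂ) * (s : ℂ) ^ i := by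
    rw [Complex.ofReal_cpow hs.1.le, ← Complex.cpow_natCast, ← Complex.cpow_add]
    · congr 1
      push_cast
      ring
    · exact_mod_cast hs.1.ne'
  have h2 : (1 - (s : ℂ)) ^ (((j + 1 : ℝ) : ℂ) - 1) = (1 - (s : ℂ)) ^ j := by
    rw [← Complex.cpow_natCast]
    congr 1
    push_cast
    ring
  simp only [h1, h2]
  ring

theorem iteratedDeriv_scaledBeta_zero {a : ℝ} (ha : -1 < a) {b c : ℝ → ℝ} (hb : BddSmooth b)
    (hc : BddSmooth c) {B C : ℕ → ℝ} (hB : ∀ n, iteratedDeriv n b 0 = n.factorial * B n)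
    (hC : ∀ n, iteratedDeriv n c 0 = n.factorial * C n) (n : ℕ) :
    iteratedDeriv n (scaledBeta a b c) 0 = n.factorial *
      ∑ k ∈ Finset.range (n + 1), B (n - k) * C k * Real.Gamma ((k : ℝ) + 1) *
        Real.Gamma (a + (n : ℝ) - (k : ℝ) + 1) / Real.Gamma ((n : ℝ) + a + 2) := by
  rw [(contDiff_scaledBeta ha hb hc).2 n 0, ← Finset.sum_range_reflect]
  simp only [iteratedDeriv_mul_scaled hb.contDiff hc.contDiff, mul_zero, hB, hC, Finset.mul_sum]
  have hint (i j : ℕ) : IntegrableOn (fun s : ℝ => s ^ a * (s ^ i * (1 - s) ^ j)) (Ioc 0 1) := by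
    refine (integrableOn_rpow_Ioc ha).mul_continuousOn_of_subset (K := Icc 0 1) ?_
      measurableSet_Ioc isCompact_Icc Ioc_subset_Icc_self
    exact Continuous.continuousOn (by fun_prop)
  have hrw (s : ℝ) (i : ℕ) : s ^ a * ((n.choose i : ℝ) * (s ^ i * (i.factorial * B i)) *
      ((1 - s) ^ (n - i) * ((n - i).factorial * C (n - i)))) =
      (n.choose i * i.factorial * (n - i).factorial * B i * C (n - i) : ℝ) *
        (s ^ a * (s ^ i * (1 - s) ^ (n - i))) := by ring
  simp only [hrw]
  rw [integral_finsetSum _ fun i _ => (hint i (n - i)).const_mul _]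
  refine Finset.sum_congr rfl fun i hi => ?_
  have hi' : i ≤ n := Nat.lt_succ_iff.1 (Finset.mem_range.1 hi)
  rw [integral_const_mul, integral_rpow_mul_pow_mul_one_sub_pow ha]
  have e1 : n + 1 - 1 - i = n - i := by omega
  have e2 : n - (n - i) = i := by omega
  have hf : (n.choose i * i.factorial * (n - i).factorial : ℝ) = n.factorial := by
    exact_mod_cast Nat.choose_mul_factorial_mul_factorial hi'
  have e3 : a + i + ((n - i : ℕ) : ℝ) + 2 = n + a + 2 := by push_cast [hi']; ring
  have e4 : a + n - ((n - i : ℕ) : ℝ) + 1 = a + i + 1 := by push_cast [hi']; ring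
  rw [e1, e2, e3, e4, hf]
  ring

theorem DecaysFast.bddSmooth_one_sub_mul {F : ℝ → ℝ} (hF : ∀ x ≠ 0, ContDiffAt ℝ ∞ F x)
    (hd : DecaysFast F) (χ : ContDiffBump (0 : ℝ)) : BddSmooth fun x => (1 - χ x) * F x := by
  have hsm : ContDiff ℝ ∞ fun x => (1 - χ x) * F x := by
    refine contDiff_iff_contDiffAt.2 fun x => ?_
    rcases eq_or_ne x 0 with rfl | hx
    · refine (contDiffAt_const (c := (0 : ℝ))).congr_of_eventuallyEq ?_
      filter_upwards [χ.eventuallyEq_one] with y hy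
      simp [hy]
    · exact (contDiffAt_const.sub χ.contDiffAt).mul (hF x hx)
  refine ⟨hsm, fun n => ?_⟩
  obtain ⟨x₀, hx₀, H, hanti, -, hH⟩ := hd n
  obtain ⟨M, hM⟩ := (isCompact_Icc
    (a := -(x₀ + 1 + χ.rOut)) (b := x₀ + 1 + χ.rOut)).exists_bound_of_continuousOn
    (hsm.continuous_iteratedDeriv n (by exact_mod_cast le_top)).continuousOn
  refine ⟨max M (H (x₀ + 1)), fun x => ?_⟩
  by_cases hx : |x| ≤ x₀ + 1 + χ.rOut
  · exact le_max_of_le_left (hM x (abs_le.1 hx))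
  · push Not at hx
    refine le_max_of_le_right ?_
    have hr := χ.rOut_pos
    have heq : (fun x => (1 - χ x) * F x) =ᶠ[𝓝 x] F := by
      have : ∀ᶠ y in 𝓝 x, x₀ + 1 + χ.rOut < |y| :=
        continuous_abs.continuousAt.eventually_const_lt hx
      filter_upwards [this] with y hy
      rw [χ.zero_of_le_dist (by rw [Real.dist_eq, sub_zero]; linarith)]
      ring
    rw [heq.iteratedDeriv_eq]
    refine (hH x (by linarith)).trans (hanti ?_ ?_ ?_)
    · exact mem_Ioi.2 (by linarith)
    · exact mem_Ioi.2 (by linarith)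
    · linarith

theorem exists_bddSmooth_bump_mul_tsum {B : ℕ → ℝ} {ε : ℝ} (hε : 0 < ε)
    (hB : ∀ x ∈ Ioo (-ε) ε, Summable fun n => B n * x ^ n) :
    ∃ δ > 0, ∀ χ : ContDiffBump (0 : ℝ), χ.rOut < δ →
      BddSmooth (fun x => χ x * ∑' n, B n * x ^ n) ∧
      ∀ n, iteratedDeriv n (fun x => χ x * ∑' n, B n * x ^ n) 0 = n.factorial * B n := by
  set f : ℝ → ℝ := fun x => ∑' n, B n * x ^ n with hf
  have hps : HasFPowerSeriesAt f (FormalMultilinearSeries.ofScalars ℝ B) 0 := by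
    refine hasFPowerSeriesAt_iff.2 ?_
    filter_upwards [Ioo_mem_nhds (neg_lt_zero.2 hε) hε] with x hx
    simpa [hf, mul_comm, FormalMultilinearSeries.coeff_ofScalars] using (hB x hx).hasSum
  obtain ⟨δ, hδ, hball⟩ := Metric.eventually_nhds_iff.1 hps.analyticAt.eventually_analyticAt
  refine ⟨δ, hδ, fun χ hχ => ⟨BddSmooth.of_hasCompactSupport ?_ χ.hasCompactSupport.mul_right, ?_⟩⟩
  · refine contDiff_iff_contDiffAt.2 fun x => ?_
    by_cases hx : dist x 0 < δ
    · exact χ.contDiffAt.mul (hball hx).contDiffAt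
    · refine (contDiffAt_const (c := (0 : ℝ))).congr_of_eventuallyEq ?_
      have : ∀ᶠ y in 𝓝 x, χ.rOut < dist y 0 :=
        (continuous_id.dist continuous_const).continuousAt.eventually_const_lt
          (by simpa using hχ.trans_le (not_lt.1 hx))
      filter_upwards [this] with y hy
      rw [χ.zero_of_le_dist hy.le, zero_mul]
  · intro n
    have heq : (fun x => χ x * f x) =ᶠ[𝓝 0] f := by
      filter_upwards [χ.eventuallyEq_one] with y hy
      simp [hy]
    obtain ⟨r, hr⟩ := hps
    have h := hr.factorial_smul 1 n
    rw [heq.iteratedDeriv_eq, iteratedDeriv_eq_iteratedFDeriv]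
    rw [← h]
    simp [nsmul_eq_mul]

theorem integral_Ioc_rpow_mul_mul_sub {a x : ℝ} (hx : 0 < x) (b c : ℝ → ℝ) :
    ∫ y in Ioc 0 x, y ^ a * b y * c (x - y) = x ^ (a + 1) * scaledBeta a b c x := by
  have h := intervalIntegral.mul_integral_comp_mul_left (a := 0) (b := 1)
    (f := fun y => y ^ a * b y * c (x - y)) x
  rw [mul_zero, mul_one, intervalIntegral.integral_of_le hx.le,
    intervalIntegral.integral_of_le zero_le_one] at h
  rw [← h, Real.rpow_add_one hx.ne', mul_comm (x ^ a), mul_assoc, scaledBeta,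
    ← integral_const_mul (x ^ a)]
  congr 1
  refine setIntegral_congr_fun measurableSet_Ioc fun s hs => ?_
  rw [Real.mul_rpow hx.le hs.1.le, mul_comm x s, show x - s * x = (1 - s) * x by ring]
  ring

theorem BddSmooth.integrable_mul_comp_sub {f : ℝ → ℝ} (hf : BddSmooth f) {g : ℝ → ℝ}
    (hg : Integrable g) (x : ℝ) : Integrable fun y => g y * f (x - y) := by
  obtain ⟨M, hM⟩ := hf.bounded 0
  simp only [iteratedDeriv_zero] at hM
  exact hg.mul_bdd (hf.contDiff.continuous.comp
    (continuous_const.sub continuous_id)).aestronglyMeasurable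
    (Eventually.of_forall fun y => hM (x - y))

theorem contDiffAt_of_contDiffOn_of_eq_zero {f : ℝ → ℝ} {s t : Set ℝ} (hs : IsOpen s)
    (ht : IsOpen t) (hf : ContDiffOn ℝ ∞ f s) (hft : ∀ x ∈ t, f x = 0) {x : ℝ}
    (hx : x ∈ s ∪ t) : ContDiffAt ℝ ∞ f x := by
  rcases hx with hx | hx
  · exact hf.contDiffAt (hs.mem_nhds hx)
  · refine (contDiffAt_const (c := (0 : ℝ))).congr_of_eventuallyEq ?_
    filter_upwards [ht.mem_nhds hx] with y hy using hft y hy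

theorem exists_conv_eq_smooth_sub_rpow_mul {a : ℝ} (ha : -1 < a) {F₁ F₂ : ℝ → ℝ} {B C : ℕ → ℝ}
    {ε : ℝ} (hε : 0 < ε)
    (hsuppF₁ : ∀ x ≤ (0:ℝ), F₁ x = 0) (hsuppF₂ : ∀ x ≥ (0:ℝ), F₂ x = 0)
    (hintF₁ : IntegrableOn F₁ (Ioi 0)) (hintF₂ : IntegrableOn F₂ (Iio 0))
    (hsumB : ∀ x ∈ Ioo (-ε) ε, Summable fun n => B n * x ^ n)
    (hsumC : ∀ x ∈ Ioo (-ε) ε, Summable fun n => C n * x ^ n)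
    (hF₁ : ∀ x ∈ Ioo (0:ℝ) ε, F₁ x = x ^ a * ∑' n, B n * x ^ n)
    (hF₂ : ∀ x ∈ Ioo (-ε) (0:ℝ), F₂ x = ∑' n, C n * x ^ n)
    (hsmF₁ : ContDiffOn ℝ ∞ F₁ (Ioi 0)) (hsmF₂ : ContDiffOn ℝ ∞ F₂ (Iio 0))
    (hdF₁ : DecaysFast F₁) (hdF₂ : DecaysFast F₂) :
    ∃ S R : ℝ → ℝ, ContDiff ℝ ∞ S ∧ ContDiff ℝ ∞ R ∧
      (∀ x ≤ 0, conv F₁ F₂ x = S x) ∧ (∀ x > 0, conv F₁ F₂ x = S x - x ^ (a + 1) * R x) ∧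
      ∀ n, iteratedDeriv n R 0 = n.factorial *
        ∑ k ∈ Finset.range (n + 1), B (n - k) * C k * Real.Gamma ((k : ℝ) + 1) *
          Real.Gamma (a + (n : ℝ) - (k : ℝ) + 1) / Real.Gamma ((n : ℝ) + a + 2) := by
  obtain ⟨δ₁, hδ₁, hb⟩ := exists_bddSmooth_bump_mul_tsum hε hsumB
  obtain ⟨δ₂, hδ₂, hc⟩ := exists_bddSmooth_bump_mul_tsum hε hsumC
  obtain ⟨r, hr, hrm⟩ := exists_between (lt_min hε (lt_min hδ₁ hδ₂))
  obtain ⟨hrε, hrδ₁, hrδ₂⟩ : r < ε ∧ r < δ₁ ∧ r < δ₂ := by simpa using hrm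
  let χ : ContDiffBump (0 : ℝ) := ⟨r / 2, r, half_pos hr, half_lt_self hr⟩
  obtain ⟨hb, hbB⟩ := hb χ hrδ₁
  obtain ⟨hc, hcC⟩ := hc χ hrδ₂
  set b : ℝ → ℝ := fun x => χ x * ∑' n, B n * x ^ n with hbdef
  set c : ℝ → ℝ := fun x => χ x * ∑' n, C n * x ^ n with hcdef
  have hχ (x : ℝ) (hx : ε ≤ |x|) : χ x = 0 :=
    χ.zero_of_le_dist (by rw [Real.dist_eq, sub_zero]; exact hrε.le.trans hx)
  have hf₁ := hdF₁.bddSmooth_one_sub_mul (fun x hx => contDiffAt_of_contDiffOn_of_eq_zero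
    isOpen_Ioi isOpen_Iio hsmF₁ (fun y hy => hsuppF₁ y (le_of_lt hy)) (hx.lt_or_gt.symm)) χ
  have hf₂ := hdF₂.bddSmooth_one_sub_mul (fun x hx => contDiffAt_of_contDiffOn_of_eq_zero
    isOpen_Iio isOpen_Ioi hsmF₂ (fun y hy => hsuppF₂ y (le_of_lt hy)) hx.lt_or_gt) χ
  set f₁ : ℝ → ℝ := fun x => (1 - χ x) * F₁ x with hf₁def
  set f₂ : ℝ → ℝ := fun x => (1 - χ x) * F₂ x with hf₂def
  have hF₁i : Integrable F₁ := (integrableOn_iff_integrable_of_support_subset fun x hx => by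
    by_contra h; exact hx (hsuppF₁ x (not_lt.1 h))).1 hintF₁
  have hF₂i : Integrable F₂ := (integrableOn_iff_integrable_of_support_subset fun x hx => by
    by_contra h; exact hx (hsuppF₂ x (not_lt.1 h))).1 hintF₂
  set g : ℝ → ℝ := fun x => F₁ x * χ x with hgdef
  have hg : Integrable g := hF₁i.mul_bdd (c := 1) χ.continuous.aestronglyMeasurable
    (Eventually.of_forall fun x => by
      rw [Real.norm_eq_abs, abs_of_nonneg χ.nonneg]; exact χ.le_one)
  have hgpos (x : ℝ) (hx : 0 < x) : g x = x ^ a * b x := by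
    by_cases h : x < ε
    · simp only [hgdef, hbdef, hF₁ x ⟨hx, h⟩]; ring
    · simp [hgdef, hbdef, hχ x (by rw [abs_of_pos hx]; linarith)]
  have hgneg (x : ℝ) (hx : x ≤ 0) : g x = 0 := by simp [hgdef, hsuppF₁ x hx]
  have hk (x : ℝ) (hx : x < 0) : χ x * F₂ x = c x := by
    by_cases h : -ε < x
    · simp only [hcdef, hF₂ x ⟨h, hx⟩]
    · simp [hcdef, hχ x (by rw [abs_of_neg hx]; linarith)]
  have hconv (x : ℝ) : conv F₁ F₂ x = (∫ y, F₂ y * f₁ (x - y)) + (∫ y, g y * f₂ (x - y)) +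
      (∫ y, g y * c (x - y)) - ∫ y in Iic x, g y * c (x - y) := by
    have i₁ := hf₁.integrable_mul_comp_sub hF₂i x
    have i₂ := hf₂.integrable_mul_comp_sub hg x
    have i₃ := hc.integrable_mul_comp_sub hg x
    have i₁' : Integrable fun y => F₂ (x - y) * f₁ y := by
      simpa using i₁.comp_sub_left x
    have e₁ : ∫ y, F₂ y * f₁ (x - y) = ∫ y, F₂ (x - y) * f₁ y := by
      rw [← integral_sub_left_eq_self (fun y => F₂ y * f₁ (x - y)) volume x]
      simp
    have i₄ := i₃.indicator (measurableSet_Iic (a := x))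
    have i₁₂ : Integrable fun y => F₂ (x - y) * f₁ y + g y * f₂ (x - y) := i₁'.add i₂
    have i₁₂₃ : Integrable fun y => F₂ (x - y) * f₁ y + g y * f₂ (x - y) + g y * c (x - y) :=
      i₁₂.add i₃
    rw [e₁, ← integral_indicator measurableSet_Iic, ← integral_add i₁' i₂,
      ← integral_add i₁₂ i₃, ← integral_sub i₁₂₃ i₄, conv]
    refine integral_congr_ae (Eventually.of_forall fun y => ?_)
    by_cases hy : y ≤ x
    · simp [indicator_of_mem (mem_Iic.2 hy), hsuppF₂ (x - y) (by linarith), hf₂def]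
    · simp only [indicator_of_notMem (fun h => hy (mem_Iic.1 h)), ← hk (x - y) (by linarith),
        hf₂def, hf₁def, hgdef]
      ring
  obtain ⟨hR, hR'⟩ := contDiff_scaledBeta ha hb hc
  refine ⟨_, scaledBeta a b c, ((hf₁.contDiff_convolution hF₂i).add
    (hf₂.contDiff_convolution hg)).add (hc.contDiff_convolution hg), hR, ?_, ?_,
    iteratedDeriv_scaledBeta_zero ha hb hc hbB hcC⟩
  · intro x hx
    rw [hconv, setIntegral_eq_zero_of_forall_eq_zero, sub_zero]
    intro y hy
    rw [hgneg y (le_trans hy hx), zero_mul]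
  · intro x hx
    rw [hconv, ← integral_Ioc_rpow_mul_mul_sub hx]
    congr 1
    have hsub : Ioc 0 x ⊆ Iic x := Ioc_subset_Iic_self
    rw [setIntegral_eq_of_subset_of_forall_sdiff_eq_zero (f := fun y => g y * c (x - y))
      measurableSet_Iic hsub]
    · exact setIntegral_congr_fun measurableSet_Ioc fun y hy => by
        simp only [hgpos y hy.1]
    · intro y hy
      rw [hgneg y (not_lt.1 fun h => hy.2 ⟨h, hy.1⟩), zero_mul]

theorem DecaysFast.exists_summable_bound {h : ℝ → ℝ} (hh : ∀ x ≠ 0, ContDiffAt ℝ ∞ h x)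
    (hd : DecaysFast h) (n : ℕ) : ∃ u : ℤ → ℝ, Summable u ∧ ∀ k : ℤ, k ≠ 0 →
      ∀ x ∈ Icc (-(1 / 4) : ℝ) (1 / 4), |iteratedDeriv n h (x + k)| ≤ u k := by
  have hloc : ∀ k : ℤ, ∃ M, k ≠ 0 →
      ∀ x ∈ Icc (-(1 / 4) : ℝ) (1 / 4), |iteratedDeriv n h (x + k)| ≤ M := by
    intro k
    by_cases hk : k = 0
    · exact ⟨0, fun h => absurd hk h⟩
    have hcont : ContinuousOn (fun x : ℝ => iteratedDeriv n h (x + k)) (Icc (-(1 / 4)) (1 / 4)) := by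
      intro x hx
      have hne : x + k ≠ 0 := by
        have h1 : (1 : ℝ) ≤ |(k : ℝ)| := by exact_mod_cast Int.one_le_abs hk
        intro h0
        have : |x| ≤ 1 / 4 := abs_le.2 hx
        rw [show (k : ℝ) = -x by linarith, abs_neg] at h1
        linarith
      exact ((hasDerivAt_iteratedDeriv (hh _ hne) n).continuousAt.comp
        (f := fun x : ℝ => x + k) (by fun_prop)).continuousWithinAt
    obtain ⟨M, hM⟩ := isCompact_Icc.exists_bound_of_continuousOn hcont
    exact ⟨M, fun _ => hM⟩
  choose M hM using hloc
  obtain ⟨x₀, hx₀, H, hanti, hint, hH⟩ := hd n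
  obtain ⟨N, hN⟩ := exists_nat_gt x₀
  have hsub : Ici (N : ℝ) ⊆ Ioi x₀ := fun t ht => lt_of_lt_of_le hN ht
  have hHsum : Summable fun m : ℕ => H m := by
    refine AntitoneOn.summable_of_integrableOn_Ioi (N := N) (hanti.mono hsub)
      (hint.mono_set (Ioi_subset_Ici_self.trans hsub)) fun t ht => ?_
    have ht' : x₀ < t := hsub (Ioi_subset_Ici_self ht)
    have := hH t (by rwa [abs_of_pos (hx₀.trans ht')])
    rw [abs_of_pos (hx₀.trans ht')] at this
    exact (abs_nonneg _).trans this
  let u : ℤ → ℝ := fun k => if k.natAbs ≤ N then M k else H ((k.natAbs - 1 : ℕ) : ℝ)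
  have hu (f : ℕ → ℤ) (hf : ∀ m, (f m).natAbs = m) : Summable fun m => u (f m) := by
    rw [← summable_nat_add_iff (N + 1)]
    refine ((summable_nat_add_iff N).2 hHsum).congr fun m => ?_
    simp only [u, hf]
    rw [if_neg (by omega)]
    rfl
  refine ⟨u, Summable.of_nat_of_neg (hu (fun m => m) (by simp)) (hu (fun m => -m) (by simp)), ?_⟩
  intro k hk x hx
  by_cases hkN : k.natAbs ≤ N
  · simp only [u, if_pos hkN]
    exact hM k hk x hx
  · simp only [u, if_neg hkN]
    have hx' : |x| ≤ 1 / 4 := abs_le.2 hx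
    have h1 : ((k.natAbs - 1 : ℕ) : ℝ) = |(k : ℝ)| - 1 := by
      rw [Nat.cast_sub (by omega), Nat.cast_natAbs]
      push_cast
      ring
    have h2 : (N : ℝ) ≤ ((k.natAbs - 1 : ℕ) : ℝ) := by exact_mod_cast (by omega)
    have h3 : ((k.natAbs - 1 : ℕ) : ℝ) ≤ |x + k| := by
      rw [h1]
      have := abs_sub_abs_le_abs_sub (k : ℝ) (-x)
      rw [abs_neg, sub_neg_eq_add, add_comm (k : ℝ) x] at this
      linarith
    exact (hH _ (hN.trans_le (h2.trans h3))).trans (hanti (hN.trans_le h2)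
      (hN.trans_le (h2.trans h3)) h3)

theorem DecaysFast.exists_tsum_eq_add_smooth {h : ℝ → ℝ} (hh : ∀ x ≠ 0, ContDiffAt ℝ ∞ h x)
    (hd : DecaysFast h) : ∃ T : ℝ → ℝ, ContDiffOn ℝ ∞ T (Ioo (-(1 / 4)) (1 / 4)) ∧
      ∀ x ∈ Ioo (-(1 / 4) : ℝ) (1 / 4), ∑' k : ℤ, h (x + k) = h x + T x := by
  choose u hu hbd using hd.exists_summable_bound hh
  let g : ℕ → ℤ → ℝ → ℝ := fun n k x => if k = 0 then 0 else iteratedDeriv n h (x + k)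
  have hg (n : ℕ) (k : ℤ) (x : ℝ) (hx : x ∈ Ioo (-(1 / 4) : ℝ) (1 / 4)) : ‖g n k x‖ ≤ |u n k| := by
    by_cases hk : k = 0
    · simp [g, hk]
    · simp only [g, if_neg hk]
      exact (hbd n k hk x (Ioo_subset_Icc_self hx)).trans (le_abs_self _)
  have hsum (n : ℕ) (x : ℝ) (hx : x ∈ Ioo (-(1 / 4) : ℝ) (1 / 4)) : Summable fun k => g n k x :=
    Summable.of_norm_bounded (hu n).abs fun k => hg n k x hx
  have hderiv (n : ℕ) (k : ℤ) (x : ℝ) (hx : x ∈ Ioo (-(1 / 4) : ℝ) (1 / 4)) :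
      HasDerivAt (g n k) (g (n + 1) k x) x := by
    by_cases hk : k = 0
    · simp only [g, if_pos hk]
      exact hasDerivAt_const x (0 : ℝ)
    · simp only [g, if_neg hk]
      have hne : x + k ≠ 0 := by
        have h1 : (1 : ℝ) ≤ |(k : ℝ)| := by exact_mod_cast Int.one_le_abs hk
        intro h0
        have : |x| ≤ 1 / 4 := abs_le.2 (Ioo_subset_Icc_self hx)
        rw [show (k : ℝ) = -x by linarith, abs_neg] at h1
        linarith
      exact (hasDerivAt_iteratedDeriv (hh _ hne) n).comp_add_const x k
  refine ⟨fun x => ∑' k, g 0 k x, contDiffOn_infty_of_hasDerivAt_succ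
    (φ := fun n x => ∑' k, g n k x) isOpen_Ioo fun n x hx => ?_, fun x hx => ?_⟩
  · exact hasDerivAt_tsum_of_isPreconnected (hu (n + 1)).abs isOpen_Ioo isPreconnected_Ioo
      (fun k y hy => hderiv n k y hy) (fun k y hy => hg (n + 1) k y hy) hx (hsum n x hx) hx
  · have h0 : HasSum (fun k : ℤ => if k = 0 then h x else 0) (h x) := by
      simpa using hasSum_ite_eq (0 : ℤ) (h x)
    refine ((h0.add (hsum 0 x hx).hasSum).congr_fun ?_).tsum_eq
    intro k
    by_cases hk : k = 0 <;> simp [g, hk]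

open Asymptotics

theorem isLittleO_sub_sum_iteratedDeriv {f : ℝ → ℝ} {δ : ℝ} (hδ : 0 < δ)
    (hf : ContDiffOn ℝ ∞ f (Ioo (-δ) δ)) (n : ℕ) :
    (fun x => f x - ∑ k ∈ Finset.range (n + 1), (k.factorial : ℝ)⁻¹ * x ^ k * iteratedDeriv k f 0)
      =o[𝓝 0] fun x => x ^ n := by
  have h0 : (0 : ℝ) ∈ Ioo (-δ) δ := ⟨neg_lt_zero.2 hδ, hδ⟩
  have h := taylor_isLittleO (n := n) (convex_Ioo (-δ) δ) h0 (contDiffOn_infty.1 hf n)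
  rw [isOpen_Ioo.nhdsWithin_eq h0] at h
  simpa only [taylor_within_apply, sub_zero, smul_eq_mul,
    iteratedDerivWithin_of_isOpen isOpen_Ioo h0] using h

theorem iteratedDeriv_eq_zero_of_isLittleO {f : ℝ → ℝ} {δ : ℝ} (hδ : 0 < δ)
    (hf : ContDiffOn ℝ ∞ f (Ioo (-δ) δ)) {l : Filter ℝ} [l.NeBot] (hl : l ≤ 𝓝[≠] 0)
    (ho : ∀ n : ℕ, f =o[l] fun x => x ^ n) (n : ℕ) : iteratedDeriv n f 0 = 0 := by
  induction n using Nat.strong_induction_on with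
  | _ n ih =>
    have h := (isLittleO_sub_sum_iteratedDeriv hδ hf n).mono (hl.trans nhdsWithin_le_nhds)
    have h1 := (ho n).sub h
    have h2 : (fun x : ℝ => x ^ n * ((n.factorial : ℝ)⁻¹ * iteratedDeriv n f 0)) =o[l]
        fun x => x ^ n * (1 : ℝ) := by
      refine h1.congr (fun x => ?_) fun x => (mul_one _).symm
      rw [sub_sub_cancel, Finset.sum_range_succ, Finset.sum_eq_zero, zero_add]
      · ring
      · intro k hk
        rw [ih k (Finset.mem_range.1 hk), mul_zero]
    have hne : ∀ᶠ x in l, x ≠ 0 := hl self_mem_nhdsWithin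
    have h3 : (fun _ : ℝ => (n.factorial : ℝ)⁻¹ * iteratedDeriv n f 0) =o[l] fun _ => (1 : ℝ) := by
      have h4 := (isBigO_refl (fun x : ℝ => (x ^ n)⁻¹) l).mul_isLittleO h2
      refine h4.congr' ?_ ?_ <;>
      · filter_upwards [hne] with x hx
        field_simp
    rw [isLittleO_one_iff, tendsto_const_nhds_iff] at h3
    exact (mul_eq_zero.1 h3).resolve_left (inv_ne_zero (by exact_mod_cast n.factorial_ne_zero))

theorem iteratedDeriv_eq_zero_of_smooth_eq_rpow_mul {a : ℝ} (ha : a < 0) {D Q : ℝ → ℝ} {δ : ℝ}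
    (hδ : 0 < δ) (hD : ContDiffOn ℝ ∞ D (Ioo (-δ) δ)) (hQ : ContDiff ℝ ∞ Q)
    (hneg : ∀ x ∈ Ioo (-δ) 0, D x = 0) (hpos : ∀ x ∈ Ioo 0 δ, D x = x ^ (a + 1) * Q x) (n : ℕ) :
    iteratedDeriv n Q 0 = 0 := by
  have hD0 := iteratedDeriv_eq_zero_of_isLittleO hδ hD (l := 𝓝[<] 0) (nhdsLT_le_nhdsNE 0)
    fun n => by
      refine (isLittleO_zero (fun x : ℝ => x ^ n) (𝓝[<] 0)).congr' ?_ EventuallyEq.rfl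
      filter_upwards [Ioo_mem_nhdsLT (neg_lt_zero.2 hδ)] with x hx
      exact (hneg x hx).symm
  refine iteratedDeriv_eq_zero_of_isLittleO hδ hQ.contDiffOn (l := 𝓝[>] 0) (nhdsGT_le_nhdsNE 0)
    (fun m => ?_) n
  have h : D =o[𝓝[>] 0] fun x => x ^ (m + 1) := by
    simpa [hD0] using (isLittleO_sub_sum_iteratedDeriv hδ hD (m + 1)).mono
      (nhdsWithin_le_nhds (s := Ioi 0))
  have h1 := (isBigO_refl (fun x : ℝ => (x ^ (a + 1))⁻¹) (𝓝[>] 0)).mul_isLittleO h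
  have h2 : (fun x : ℝ => x ^ (-a)) =O[𝓝[>] 0] fun _ => (1 : ℝ) := by
    refine IsBigO.of_bound 1 ?_
    filter_upwards [Ioo_mem_nhdsGT (zero_lt_one' ℝ)] with x hx
    rw [Real.norm_eq_abs, abs_of_pos (Real.rpow_pos_of_pos hx.1 _), norm_one, one_mul]
    exact Real.rpow_le_one hx.1.le hx.2.le (by linarith)
  have h3 := h2.mul (isBigO_refl (fun x : ℝ => x ^ m) (𝓝[>] 0))
  refine (h1.congr' (f₂ := Q) (g₂ := fun x => x ^ (-a) * x ^ m) ?_ ?_).trans_isBigO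
    (by simpa using h3)
  · filter_upwards [Ioo_mem_nhdsGT hδ] with x hx
    rw [hpos x hx, inv_mul_cancel_left₀ (Real.rpow_pos_of_pos hx.1 _).ne']
  · filter_upwards [self_mem_nhdsWithin] with x hx
    have hx : (0 : ℝ) < x := hx
    rw [Real.rpow_add_one hx.ne', Real.rpow_neg hx.le, pow_succ]
    have := (Real.rpow_pos_of_pos hx a).ne'
    field_simp

theorem contDiffAt_of_eq_smooth_sub_rpow_mul {a : ℝ} {h S R : ℝ → ℝ} (hS : ContDiff ℝ ∞ S)
    (hR : ContDiff ℝ ∞ R) (hneg : ∀ x ≤ 0, h x = S x)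
    (hpos : ∀ x > 0, h x = S x - x ^ (a + 1) * R x) {x : ℝ} (hx : x ≠ 0) :
    ContDiffAt ℝ ∞ h x := by
  rcases hx.lt_or_gt with hx | hx
  · refine hS.contDiffAt.congr_of_eventuallyEq ?_
    filter_upwards [Iio_mem_nhds hx] with y hy using hneg y (le_of_lt hy)
  · refine (hS.contDiffAt.sub ((contDiffAt_id.rpow_const_of_ne (p := a + 1) hx.ne').mul
      hR.contDiffAt)).congr_of_eventuallyEq ?_
    filter_upwards [Ioi_mem_nhds hx] with y hy using hpos y hy
/-- the periodization of `F₁*F₂` (with `F₁(x) = x^a ∑ Bₙxⁿ` near `0⁺`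
supported on `(0,∞)`, `F₂(x) = ∑ Cₙxⁿ` near `0⁻` supported on `(−∞,0)`) determines
the combined coefficients `∑_k B_{n−k}C_k Γ(k+1)Γ(a+n−k+1)/Γ(n+a+2)` for `n ≥ 1`. -/
theorem stmt7 (a : ℝ) (ha : a ∈ Ioo (-1 : ℝ) 0)
    (F₁ F₂ G₁ G₂ : ℝ → ℝ) (B B' C C' : ℕ → ℝ) (ε : ℝ) (hε : 0 < ε)
    (hsuppF₁ : ∀ x ≤ (0:ℝ), F₁ x = 0) (hsuppG₁ : ∀ x ≤ (0:ℝ), G₁ x = 0)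
    (hsuppF₂ : ∀ x ≥ (0:ℝ), F₂ x = 0) (hsuppG₂ : ∀ x ≥ (0:ℝ), G₂ x = 0)
    (hintF₁ : IntegrableOn F₁ (Ioi 0)) (hintG₁ : IntegrableOn G₁ (Ioi 0))
    (hintF₂ : IntegrableOn F₂ (Iio 0)) (hintG₂ : IntegrableOn G₂ (Iio 0))
    (hsumB : ∀ x ∈ Ioo (-ε) ε, Summable fun n => B n * x ^ n)
    (hsumB' : ∀ x ∈ Ioo (-ε) ε, Summable fun n => B' n * x ^ n)
    (hsumC : ∀ x ∈ Ioo (-ε) ε, Summable fun n => C n * x ^ n)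
    (hsumC' : ∀ x ∈ Ioo (-ε) ε, Summable fun n => C' n * x ^ n)
    (hF₁ : ∀ x ∈ Ioo (0:ℝ) ε, F₁ x = x ^ a * ∑' n, B n * x ^ n)
    (hG₁ : ∀ x ∈ Ioo (0:ℝ) ε, G₁ x = x ^ a * ∑' n, B' n * x ^ n)
    (hF₂ : ∀ x ∈ Ioo (-ε) (0:ℝ), F₂ x = ∑' n, C n * x ^ n)
    (hG₂ : ∀ x ∈ Ioo (-ε) (0:ℝ), G₂ x = ∑' n, C' n * x ^ n)
    (hsmF₁ : ContDiffOn ℝ (⊤ : ℕ∞) F₁ (Ioi 0)) (hsmG₁ : ContDiffOn ℝ (⊤ : ℕ∞) G₁ (Ioi 0))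
    (hsmF₂ : ContDiffOn ℝ (⊤ : ℕ∞) F₂ (Iio 0)) (hsmG₂ : ContDiffOn ℝ (⊤ : ℕ∞) G₂ (Iio 0))
    (hdF₁ : DecaysFast F₁) (hdF₂ : DecaysFast F₂)
    (hdG₁ : DecaysFast G₁) (hdG₂ : DecaysFast G₂)
    (hdFF : DecaysFast (conv F₁ F₂)) (hdGG : DecaysFast (conv G₁ G₂))
    (heq : ∀ x ∈ Ioo (-(1/2) : ℝ) (1/2), x ≠ 0 →
      (∑' k : ℤ, conv F₁ F₂ (x + (k : ℝ))) = ∑' k : ℤ, conv G₁ G₂ (x + (k : ℝ))) :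
    ∀ n : ℕ, 1 ≤ n →
      (∑ k ∈ Finset.range (n + 1), B (n - k) * C k *
          Real.Gamma ((k : ℝ) + 1) * Real.Gamma (a + (n : ℝ) - (k : ℝ) + 1) /
          Real.Gamma ((n : ℝ) + a + 2)) =
      ∑ k ∈ Finset.range (n + 1), B' (n - k) * C' k *
          Real.Gamma ((k : ℝ) + 1) * Real.Gamma (a + (n : ℝ) - (k : ℝ) + 1) /
          Real.Gamma ((n : ℝ) + a + 2) := by
  obtain ⟨S, R, hS, hR, hSn, hSp, hRd⟩ := exists_conv_eq_smooth_sub_rpow_mul ha.1 hε hsuppF₁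
    hsuppF₂ hintF₁ hintF₂ hsumB hsumC hF₁ hF₂ hsmF₁ hsmF₂ hdF₁ hdF₂
  obtain ⟨S', R', hS', hR', hSn', hSp', hRd'⟩ := exists_conv_eq_smooth_sub_rpow_mul ha.1 hε hsuppG₁
    hsuppG₂ hintG₁ hintG₂ hsumB' hsumC' hG₁ hG₂ hsmG₁ hsmG₂ hdG₁ hdG₂
  obtain ⟨T, hT, hTeq⟩ := hdFF.exists_tsum_eq_add_smooth fun x hx =>
    contDiffAt_of_eq_smooth_sub_rpow_mul hS hR hSn hSp hx
  obtain ⟨T', hT', hTeq'⟩ := hdGG.exists_tsum_eq_add_smooth fun x hx =>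
    contDiffAt_of_eq_smooth_sub_rpow_mul hS' hR' hSn' hSp' hx
  intro n _
  have key : ∀ x ∈ Ioo (-(1 / 4) : ℝ) (1 / 4), x ≠ 0 →
      conv F₁ F₂ x + T x = conv G₁ G₂ x + T' x := fun x hx hx0 => by
    rw [← hTeq x hx, ← hTeq' x hx]
    exact heq x ⟨by linarith [hx.1], by linarith [hx.2]⟩ hx0
  have hflat := iteratedDeriv_eq_zero_of_smooth_eq_rpow_mul ha.2 (δ := 1 / 4) (by norm_num)
    (D := fun x => S x + T x - (S' x + T' x)) (Q := fun x => R x - R' x)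
    ((hS.contDiffOn.add hT).sub (hS'.contDiffOn.add hT')) (hR.sub hR')
    (fun x hx => by
      have h := key x ⟨hx.1, by linarith [hx.2]⟩ hx.2.ne
      rw [hSn x hx.2.le, hSn' x hx.2.le] at h
      exact sub_eq_zero.2 h)
    (fun x hx => by
      have h := key x ⟨by linarith [hx.1], hx.2⟩ hx.1.ne'
      rw [hSp x hx.1, hSp' x hx.1] at h
      linear_combination h) n
  rw [iteratedDeriv_fun_sub (contDiff_infty.1 hR n).contDiffAt (contDiff_infty.1 hR' n).contDiffAt,
    hRd, hRd', sub_eq_zero] at hflat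
  exact mul_left_cancel₀ (by exact_mod_cast n.factorial_ne_zero) hflat
end
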